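/- Kleitman-type theorem for the burst metric: for fixed q, d, b with q ≥ 2 and all sufficiently large n, any set A ⊆ Σ_q^n whose burst diameter is at most 2d (i.e., d_b(x,y) ≤ 2d for all x, y ∈ A) satisfies |A| ≤ |Ball_{d,b}(0)|, with equality if and only if A can be transformed into Ball_{d,b}(0) by a finite sequence of shifting operations. -/

import Mathlib

open scoped BigOperators

/-- The cyclic interval of length `L` starting at position `i` in `ZMod n`. -/
def cycInt (n : ℕ) (i : ZMod n) (L : ℕ) : Set (ZMod n) :=
  {j | ∃ k : ℕ, k < L ∧ j = i + (k : ZMod n)}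

/-- `e` is a burst supported in the cyclic interval starting at `i` of length `L ≤ b`. -/
def BurstAt {G : Type*} [AddCommGroup G] {n : ℕ} (b : ℕ) (e : ZMod n → G)
    (i : ZMod n) (L : ℕ) : Prop :=
  L ≤ b ∧ ∀ j : ZMod n, e j ≠ 0 → j ∈ cycInt n i L

/-- `e` is a `b≤`-burst: its support lies in a cyclic interval of length at most `b`. -/
def IsBurst {G : Type*} [AddCommGroup G] {n : ℕ} (b : ℕ) (e : ZMod n → G) : Prop :=
  ∃ i L, BurstAt b e i L

/-- `w` is a sum of exactly `t` many `b≤`-bursts. -/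
def SumOfBursts {G : Type*} [AddCommGroup G] {n : ℕ} (b t : ℕ) (w : ZMod n → G) : Prop :=
  ∃ l : List (ZMod n → G), l.length = t ∧ (∀ e ∈ l, IsBurst b e) ∧ l.sum = w

/-- The cyclic burst distance: minimum number of `b≤`-bursts summing to `x - y`. -/
noncomputable def burstDist {G : Type*} [AddCommGroup G] {n : ℕ} (b : ℕ)
    (x y : ZMod n → G) : ℕ :=
  sInf {t | SumOfBursts b t (x - y)}

/-- `w` is a sum of exactly `t` pairwise disjoint `b≤`-bursts (disjoint covering intervals). -/
def SumOfDisjointBursts {G : Type*} [AddCommGroup G] {n : ℕ} (b t : ℕ)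
    (w : ZMod n → G) : Prop :=
  ∃ (es : Fin t → ZMod n → G) (ps : Fin t → ZMod n) (Ls : Fin t → ℕ),
    (∀ m, BurstAt b (es m) (ps m) (Ls m)) ∧
    (∀ m m' : Fin t, m ≠ m' → cycInt n (ps m) (Ls m) ∩ cycInt n (ps m') (Ls m') = ∅) ∧
    ∑ m, es m = w

/-- `B_{≤t,≤b}`: vectors expressible as a sum of at most `t` pairwise disjoint `b≤`-bursts. -/
def BSet (n b t : ℕ) (G : Type*) [AddCommGroup G] : Set (ZMod n → G) :=
  {w | ∃ i ≤ t, SumOfDisjointBursts b i w}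

/-- The radius-`t` burst ball around `x`. -/
def burstBall {G : Type*} [AddCommGroup G] {n : ℕ} (b t : ℕ) (x : ZMod n → G) :
    Set (ZMod n → G) :=
  {y | burstDist b x y ≤ t}

/-- A `(t,b)`-burst-correcting code: radius-`t` burst balls around distinct codewords
are disjoint. -/
def IsBurstCorrecting {G : Type*} [AddCommGroup G] {n : ℕ} (t b : ℕ)
    (C : Set (ZMod n → G)) : Prop :=
  ∀ u ∈ C, ∀ v ∈ C, u ≠ v → burstBall b t u ∩ burstBall b t v = ∅


/-- The shifting operation S_{i,a}: replace the i-th entry of x by 0 when it equals a and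
the resulting vector is not already in A; otherwise leave x unchanged. -/
noncomputable def shiftOp {G : Type*} [AddCommGroup G] {n : ℕ} (A : Set (ZMod n → G))
    (i : ZMod n) (a : G) (x : ZMod n → G) : ZMod n → G := by
  classical
  exact if x i = a ∧ Function.update x i 0 ∉ A then Function.update x i 0 else x

namespace KB

/-- Covering by at most `t` intervals of length `b`. -/
def Cov {n : ℕ} (b t : ℕ) (X : Set (ZMod n)) : Prop :=
  ∃ P : Finset (ZMod n), P.card ≤ t ∧ ∀ j ∈ X, ∃ p ∈ P, j ∈ cycInt n p b

lemma Cov.mono {n b t s : ℕ} {X Y : Set (ZMod n)} (h : Cov b t X) (hXY : Y ⊆ X) (ht : t ≤ s) :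
    Cov b s Y := by
  obtain ⟨P, hP, hc⟩ := h
  exact ⟨P, hP.trans ht, fun j hj => hc j (hXY hj)⟩

lemma cov_of_list {G : Type*} [AddCommGroup G] {n b : ℕ} (l : List (ZMod n → G))
    (h : ∀ e ∈ l, IsBurst b e) : Cov b l.length {j | l.sum j ≠ 0} := by
  classical
  induction l with
  | nil => exact ⟨∅, by simp, by simp⟩
  | cons e l ih =>
    obtain ⟨P, hP, hc⟩ := ih (fun e he => h e (List.mem_cons_of_mem _ he))
    obtain ⟨i, L, hL, hi⟩ := h e (List.mem_cons_self)
    refine ⟨insert i P, (Finset.card_insert_le _ _).trans (by simpa using hP), ?_⟩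
    intro j hj
    by_cases he : e j = 0
    · obtain ⟨p, hp, hpj⟩ := hc j (by simpa [he] using hj)
      exact ⟨p, Finset.mem_insert_of_mem hp, hpj⟩
    · obtain ⟨k, hk, hk2⟩ := hi j he
      exact ⟨i, Finset.mem_insert_self _ _, k, by omega, hk2⟩

lemma sum_of_cov {G : Type*} [AddCommGroup G] {n b : ℕ} (P : Finset (ZMod n)) :
    ∀ w : ZMod n → G, (∀ j, w j ≠ 0 → ∃ p ∈ P, j ∈ cycInt n p b) → SumOfBursts b P.card w := by
  classical
  induction P using Finset.induction_on with
  | empty =>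
    intro w hw
    refine ⟨[], rfl, by simp, ?_⟩
    funext j
    by_contra hne
    obtain ⟨p, hp, _⟩ := hw j (fun h => hne (by simp [h]))
    simp at hp
  | insert p P hp ih =>
    intro w hw
    obtain ⟨l, hl, hb, hs⟩ := ih (fun j => if j ∈ cycInt n p b then 0 else w j) (by
      intro j hj
      have h1 : j ∉ cycInt n p b := fun h => hj (by simp [h])
      have h2 : w j ≠ 0 := by simpa [h1] using hj
      obtain ⟨p', hp', hj'⟩ := hw j h2
      rcases Finset.mem_insert.1 hp' with rfl | h
      · exact absurd hj' h1
      · exact ⟨p', h, hj'⟩)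
    refine ⟨(fun j => if j ∈ cycInt n p b then w j else 0) :: l, ?_, ?_, ?_⟩
    · simp [hl, Finset.card_insert_of_notMem hp]
    · intro e he
      rcases List.mem_cons.1 he with rfl | h
      · refine ⟨p, b, le_rfl, fun j hj => ?_⟩
        by_contra hne
        exact hj (by simp [hne])
      · exact hb e h
    · rw [List.sum_cons, hs]
      funext j
      by_cases h : j ∈ cycInt n p b <;> simp [h]

lemma burstDist_le_iff {G : Type*} [AddCommGroup G] {n : ℕ} [NeZero n] {b t : ℕ} (hb : 1 ≤ b)
    (x y : ZMod n → G) : burstDist b x y ≤ t ↔ Cov b t {j | x j ≠ y j} := by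
  constructor
  · intro h
    have hne : {t | SumOfBursts b t (x - y)}.Nonempty :=
      ⟨_, sum_of_cov Finset.univ (x - y) (fun j _ => ⟨j, Finset.mem_univ _, 0, hb, by simp⟩)⟩
    obtain ⟨l, hl, hbu, hs⟩ := Nat.sInf_mem hne
    have := cov_of_list l hbu
    rw [hs, hl] at this
    refine this.mono ?_ h
    intro j hj
    simpa [sub_eq_zero] using hj
  · rintro ⟨P, hP, hc⟩
    refine le_trans (Nat.sInf_le (sum_of_cov P (x - y) ?_)) hP
    intro j hj
    exact hc j (by simpa [sub_eq_zero] using hj)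

lemma union_cov {n b d : ℕ} {X Y : Set (ZMod n)} (hX : ¬ Cov b d X)
    (h : Cov b (2 * d) (X ∪ Y)) :
    Cov b (d - 1) {j ∈ Y | ¬ ∃ x ∈ X, ∃ p, x ∈ cycInt n p b ∧ j ∈ cycInt n p b} := by
  classical
  obtain ⟨P, hP, hc⟩ := h
  have h1 : d < (P.filter (fun p => ∃ x ∈ X, x ∈ cycInt n p b)).card := by
    by_contra hle
    refine hX ⟨_, not_lt.1 hle, fun j hj => ?_⟩
    obtain ⟨p, hp, hjp⟩ := hc j (Or.inl hj)
    exact ⟨p, Finset.mem_filter.2 ⟨hp, j, hj, hjp⟩, hjp⟩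
  have h2 := Finset.card_filter_add_card_filter_not (s := P) (fun p => ∃ x ∈ X, x ∈ cycInt n p b)
  refine ⟨P.filter (fun p => ¬ ∃ x ∈ X, x ∈ cycInt n p b), by omega, ?_⟩
  rintro j ⟨hj, hn⟩
  obtain ⟨p, hp, hjp⟩ := hc j (Or.inr hj)
  refine ⟨p, Finset.mem_filter.2 ⟨hp, ?_⟩, hjp⟩
  rintro ⟨x, hx, hxp⟩
  exact hn ⟨x, hx, p, hxp, hjp⟩

/-- interval as a finset -/
def iv (n b : ℕ) (p : ZMod n) : Finset (ZMod n) := by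
  classical exact (Finset.range b).image (fun k : ℕ => p + (k : ZMod n))

lemma mem_iv {n b : ℕ} {p j : ZMod n} : j ∈ iv n b p ↔ j ∈ cycInt n p b := by
  simp [iv, cycInt, eq_comm]

lemma card_iv (n b : ℕ) (p : ZMod n) : (iv n b p).card ≤ b := by
  classical
  simpa [iv] using Finset.card_image_le (s := Finset.range b) (f := fun k : ℕ => p + (k : ZMod n))

lemma card_supp_le {G : Type*} [AddCommGroup G] [Fintype G] {n : ℕ} [NeZero n]
    (M : Finset (ZMod n)) :
    {y : ZMod n → G | ∀ j, y j ≠ 0 → j ∈ M}.ncard ≤ Fintype.card G ^ M.card := by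
  classical
  have hinj : Set.InjOn (fun (y : ZMod n → G) (j : M) => y j)
      {y : ZMod n → G | ∀ j, y j ≠ 0 → j ∈ M} := by
    intro y hy z hz h
    funext j
    by_cases hj : j ∈ M
    · exact congrFun h ⟨j, hj⟩
    · rw [not_not.1 (fun h => hj (hy j h)), not_not.1 (fun h => hj (hz j h))]
  calc _ ≤ (Set.univ : Set (M → G)).ncard :=
        Set.ncard_le_ncard_of_injOn _ (fun _ _ => Set.mem_univ _) hinj
    _ = _ := by simp [Set.ncard_univ]

lemma finset_cover {n : ℕ} (m : ℕ) (P : Finset (ZMod n)) (h : P.card ≤ m) :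
    ∃ f : Fin m → ZMod n, ∀ p ∈ P, ∃ i, f i = p := by
  refine ⟨fun i => P.toList.getD i 0, fun p hp => ?_⟩
  obtain ⟨i, hi, rfl⟩ := List.getElem_of_mem (Finset.mem_toList.2 hp)
  have : i < P.card := by simpa using hi
  exact ⟨⟨i, by omega⟩, List.getD_eq_getElem _ _ hi⟩

lemma count_cov {G : Type*} [AddCommGroup G] [Fintype G] {n : ℕ} [NeZero n] (b m : ℕ)
    (N : Finset (ZMod n)) :
    {y : ZMod n → G | Cov b m {j | y j ≠ 0 ∧ j ∉ N}}.ncard ≤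
      n ^ m * Fintype.card G ^ (N.card + m * b) := by
  classical
  let M : (Fin m → ZMod n) → Finset (ZMod n) := fun f =>
    N ∪ Finset.univ.biUnion (fun i => iv n b (f i))
  have hM : ∀ f, (M f).card ≤ N.card + m * b := by
    intro f
    refine (Finset.card_union_le _ _).trans (Nat.add_le_add_left ?_ _)
    simpa using Finset.card_biUnion_le_card_mul (Finset.univ : Finset (Fin m)) (fun i => iv n b (f i)) b
      (fun i _ => card_iv _ _ _)
  have hsub : {y : ZMod n → G | Cov b m {j | y j ≠ 0 ∧ j ∉ N}} ⊆
      ↑((Finset.univ : Finset (Fin m → ZMod n)).biUnion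
        (fun f => ({y : ZMod n → G | ∀ j, y j ≠ 0 → j ∈ M f}).toFinset)) := by
    rintro y ⟨P, hP, hc⟩
    obtain ⟨f, hf⟩ := finset_cover m P hP
    simp only [Finset.coe_biUnion, Set.mem_iUnion, Finset.mem_coe, Set.mem_toFinset]
    refine ⟨f, Finset.mem_univ _, ?_⟩
    intro j hj
    by_cases hN : j ∈ N
    · exact Finset.mem_union_left _ hN
    · obtain ⟨p, hp, hjp⟩ := hc j ⟨hj, hN⟩
      obtain ⟨i, rfl⟩ := hf p hp
      exact Finset.mem_union_right _ (Finset.mem_biUnion.2 ⟨i, Finset.mem_univ _, mem_iv.2 hjp⟩)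
  refine (Set.ncard_le_ncard hsub (Finset.finite_toSet _)).trans ?_
  rw [Set.ncard_coe_finset]
  refine (Finset.card_biUnion_le_card_mul _ _ (Fintype.card G ^ (N.card + m * b)) ?_).trans ?_
  · intro f _
    rw [← Set.ncard_eq_toFinset_card']
    exact (card_supp_le (M f)).trans (Nat.pow_le_pow_right Fintype.card_pos (hM f))
  · simp [ZMod.card]

lemma choose_le_ball {G : Type*} [AddCommGroup G] [Fintype G] {n : ℕ} [NeZero n] {b d : ℕ}
    (hb : 1 ≤ b) (hG : 2 ≤ Fintype.card G) :
    n.choose d ≤ (burstBall b d (0 : ZMod n → G)).ncard := by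
  classical
  haveI : Nontrivial G := Fintype.one_lt_card_iff_nontrivial.1 hG
  obtain ⟨g, hg⟩ := exists_ne (0 : G)
  have h1 : ((Finset.powersetCard d (Finset.univ : Finset (ZMod n))) : Set (Finset (ZMod n))).ncard
      = n.choose d := by
    rw [Set.ncard_coe_finset, Finset.card_powersetCard]; simp [ZMod.card]
  rw [← h1]
  refine Set.ncard_le_ncard_of_injOn (fun S j => if j ∈ S then g else 0) ?_ ?_ (Set.toFinite _)
  · intro S hS
    have hS' : S.card = d := by simpa using hS
    refine (burstDist_le_iff hb _ _).2 ⟨S, hS'.le, fun j hj => ⟨j, ?_, 0, hb, by simp⟩⟩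
    by_contra hne
    simp [hne] at hj
  · intro S _ T _ h
    ext j
    have := congrFun h j
    by_cases h1 : j ∈ S <;> by_cases h2 : j ∈ T <;> simp_all

lemma arith (C d n : ℕ) (hd : 1 ≤ d) (h1 : 2 * d ≤ n) (h2 : 2 ^ d * d.factorial * C < n) :
    n ^ (d - 1) * C < n.choose d := by
  have h3 : (n + 1 - d) ^ d ≤ d.factorial * n.choose d := by
    rw [← Nat.descFactorial_eq_factorial_mul_choose]
    exact Nat.pow_sub_le_descFactorial n d
  have h4 : n ^ d ≤ 2 ^ d * (n + 1 - d) ^ d := by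
    rw [← mul_pow]; exact Nat.pow_le_pow_left (by omega) _
  have h5 : n ^ d = n ^ (d - 1) * n := by rw [← pow_succ]; congr 1; omega
  have hpos : 0 < n ^ (d - 1) := Nat.pow_pos (by omega)
  have h6 : n ^ (d - 1) * (2 ^ d * d.factorial * C) < n ^ (d-1) * n :=
    Nat.mul_lt_mul_of_pos_left h2 hpos
  have h7 : 2 ^ d * (n + 1 - d) ^ d ≤ 2 ^ d * (d.factorial * n.choose d) :=
    Nat.mul_le_mul_left _ h3
  have h8 : (2 ^ d * d.factorial) * (n ^ (d - 1) * C) < (2 ^ d * d.factorial) * n.choose d := by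
    calc _ = n ^ (d - 1) * (2 ^ d * d.factorial * C) := by ring
      _ < n ^ (d-1) * n := h6
      _ = n ^ d := h5.symm
      _ ≤ _ := h4.trans h7
      _ = _ := by ring
  exact lt_of_mul_lt_mul_left h8 (Nat.zero_le _)

def Diam {G : Type*} [AddCommGroup G] {n : ℕ} (b d : ℕ) (A : Set (ZMod n → G)) : Prop :=
  ∀ x ∈ A, ∀ y ∈ A, Cov b (2 * d) {j | x j ≠ y j}

def Fixed {G : Type*} [AddCommGroup G] {n : ℕ} (A : Set (ZMod n → G)) : Prop :=
  ∀ x ∈ A, ∀ i, Function.update x i 0 ∈ A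

lemma Fixed.zero_out {G : Type*} [AddCommGroup G] {n : ℕ} [NeZero n]
    {A : Set (ZMod n → G)} (h : Fixed A)
    (x : ZMod n → G) (hx : x ∈ A) (p : ZMod n → Prop) [DecidablePred p] :
    (fun j => if p j then 0 else x j) ∈ A := by
  classical
  have key : ∀ T : Finset (ZMod n), (fun j => if j ∈ T then 0 else x j) ∈ A := by
    intro T
    induction T using Finset.induction_on with
    | empty => simpa using hx
    | insert a T _ ih =>
      convert h _ ih a using 1
      funext j
      by_cases hja : j = a
      · subst hja; simp
      · simp [hja]
  simpa using key (Finset.univ.filter p)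

lemma Fixed.union {G : Type*} [AddCommGroup G] {n : ℕ} [NeZero n] {b d : ℕ}
    {A : Set (ZMod n → G)} (h : Fixed A) (hD : Diam b d A)
    (x y : ZMod n → G) (hx : x ∈ A) (hy : y ∈ A) :
    Cov b (2 * d) ({j | x j ≠ 0} ∪ {j | y j ≠ 0}) := by
  classical
  refine (hD x hx _ (h.zero_out y hy (fun j => x j ≠ 0))).mono ?_ le_rfl
  rintro j (hj | hj)
  · have hj' : x j ≠ 0 := hj
    simpa [hj'] using hj'
  · have hj' : y j ≠ 0 := hj
    by_cases hxj : x j = 0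
    · simpa [hxj] using hj'.symm
    · simp [hxj]

lemma fixed_main {G : Type*} [AddCommGroup G] [Fintype G] {n : ℕ} [NeZero n] {b d : ℕ}
    (hb : 1 ≤ b) (hd : 1 ≤ d) (hG : 2 ≤ Fintype.card G) (h1 : 2 * d ≤ n)
    (h2 : 2 ^ d * d.factorial * Fintype.card G ^ (2 * d * b * (b * b) + (d - 1) * b) < n)
    {A : Set (ZMod n → G)} (hF : Fixed A) (hD : Diam b d A) :
    A ⊆ burstBall b d (0 : ZMod n → G) ∨ A.ncard < (burstBall b d (0 : ZMod n → G)).ncard := by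
  classical
  by_cases hall : ∀ x ∈ A, Cov b d {j | x j ≠ 0}
  · left
    intro x hx
    refine (burstDist_le_iff hb _ _).2 ((hall x hx).mono ?_ le_rfl)
    intro j hj
    exact fun h => hj (by simp [h])
  · right
    push Not at hall
    obtain ⟨x, hx, hxc⟩ := hall
    let X : Finset (ZMod n) := Finset.univ.filter (fun j => x j ≠ 0)
    have hXcard : X.card ≤ 2 * d * b := by
      obtain ⟨P, hP, hc⟩ := hF.union hD x x hx hx
      calc X.card ≤ (P.biUnion (iv n b)).card := by
            apply Finset.card_le_card
            intro j hj
            obtain ⟨p, hp, hjp⟩ := hc j (Or.inl (by simpa [X] using hj))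
            exact Finset.mem_biUnion.2 ⟨p, hp, mem_iv.2 hjp⟩
        _ ≤ P.card * b := Finset.card_biUnion_le_card_mul _ _ _ (fun _ _ => card_iv _ _ _)
        _ ≤ _ := Nat.mul_le_mul_right _ hP
    let N : Finset (ZMod n) := X.biUnion (fun z => (Finset.range b ×ˢ Finset.range b).image
      (fun kl => z - (kl.1 : ZMod n) + (kl.2 : ZMod n)))
    have hN : N.card ≤ 2 * d * b * (b * b) := by
      refine (Finset.card_biUnion_le_card_mul _ _ (b * b) (fun z _ => ?_)).trans
        (Nat.mul_le_mul_right _ hXcard)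
      refine Finset.card_image_le.trans ?_
      simp
    have hsub : A ⊆ {y : ZMod n → G | Cov b (d - 1) {j | y j ≠ 0 ∧ j ∉ N}} := by
      intro y hy
      refine (union_cov hxc (hF.union hD x y hx hy)).mono ?_ le_rfl
      rintro j ⟨hj, hjN⟩
      refine ⟨hj, ?_⟩
      rintro ⟨z, hz, p, ⟨k, hk, hzk⟩, ⟨l, hl, hjl⟩⟩
      apply hjN
      refine Finset.mem_biUnion.2 ⟨z, by simpa [X] using hz, Finset.mem_image.2 ⟨(k, l), ?_, ?_⟩⟩
      · simp [hk, hl]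
      · simp [hzk, hjl]
    calc A.ncard ≤ _ := Set.ncard_le_ncard hsub (Set.toFinite _)
      _ ≤ n ^ (d - 1) * Fintype.card G ^ (N.card + (d - 1) * b) := count_cov _ _ _
      _ ≤ n ^ (d - 1) * Fintype.card G ^ (2 * d * b * (b * b) + (d - 1) * b) :=
        Nat.mul_le_mul_left _ (Nat.pow_le_pow_right (by omega) (Nat.add_le_add_right hN _))
      _ < n.choose d := arith _ _ _ hd h1 h2
      _ ≤ _ := choose_le_ball hb hG

lemma shift_injOn {G : Type*} [AddCommGroup G] {n : ℕ} (A : Set (ZMod n → G)) (i : ZMod n)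
    (a : G) : Set.InjOn (shiftOp A i a) A := by
  classical
  intro x hx y hy h
  unfold shiftOp at h
  split_ifs at h with h1 h2 h2
  · funext j
    by_cases hj : j = i
    · rw [hj, h1.1, h2.1]
    · simpa [hj] using congrFun h j
  · exact absurd (h ▸ hy) h1.2
  · exact absurd (h ▸ hx) h2.2
  · exact h

lemma shift_diam {G : Type*} [AddCommGroup G] {n b d : ℕ} {A : Set (ZMod n → G)} (i : ZMod n)
    (a : G) (hD : Diam b d A) : Diam b d (shiftOp A i a '' A) := by
  classical
  have mix : ∀ x ∈ A, ∀ y ∈ A, x i = a → ¬ (y i = a ∧ Function.update y i 0 ∉ A) →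
      Cov b (2 * d) {j | Function.update x i 0 j ≠ y j} := by
    intro x hx y hy hxa hn
    by_cases hya : y i = a
    · have hu : Function.update y i 0 ∈ A := by
        by_contra hc; exact hn ⟨hya, hc⟩
      refine (hD x hx _ hu).mono ?_ le_rfl
      intro j hj
      by_cases hji : j = i
      · subst hji
        simp only [Set.mem_setOf_eq, Function.update_self, hya, hxa] at hj ⊢
        exact hj.symm
      · simpa [hji] using hj
    · refine (hD x hx y hy).mono ?_ le_rfl
      intro j hj
      by_cases hji : j = i
      · subst hji
        show x j ≠ y j
        rw [hxa]; exact fun h => hya h.symm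
      · simpa [hji] using hj
  rintro _ ⟨x, hx, rfl⟩ _ ⟨y, hy, rfl⟩
  unfold shiftOp
  split_ifs with h1 h2 h2
  · refine (hD x hx y hy).mono ?_ le_rfl
    intro j hj
    by_cases hji : j = i
    · subst hji; simp at hj
    · simpa [hji] using hj
  · exact mix x hx y hy h1.1 h2
  · refine (mix y hy x hx h2.1 h1).mono ?_ le_rfl
    intro j hj
    exact fun h => hj h.symm
  · exact hD x hx y hy

/-- total support size -/
noncomputable def mu {G : Type*} [AddCommGroup G] [Fintype G] {n : ℕ} [NeZero n]
    (A : Set (ZMod n → G)) : ℕ := by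
  classical exact ∑ x ∈ (Set.toFinite A).toFinset, (Finset.univ.filter (fun j => x j ≠ 0)).card

lemma mu_shift_lt {G : Type*} [AddCommGroup G] [Fintype G] {n : ℕ} [NeZero n]
    (A : Set (ZMod n → G)) (x : ZMod n → G) (hx : x ∈ A) (i : ZMod n)
    (hi : Function.update x i 0 ∉ A) : mu (shiftOp A i (x i) '' A) < mu A := by
  classical
  have e : (Set.toFinite (shiftOp A i (x i) '' A)).toFinset = (Set.toFinite A).toFinset.image (shiftOp A i (x i)) := by
    ext; simp
  unfold mu
  rw [e, Finset.sum_image (by simpa using shift_injOn A i (x i))]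
  have hle : ∀ y : ZMod n → G, (Finset.univ.filter (fun j => Function.update y i 0 j ≠ 0)) ⊆
      (Finset.univ.filter (fun j => y j ≠ 0)) := by
    intro y j hj
    by_cases hji : j = i
    · subst hji; simp at hj
    · simpa [hji] using hj
  apply Finset.sum_lt_sum
  · intro y _
    unfold shiftOp
    split_ifs
    · exact Finset.card_le_card (hle y)
    · exact le_rfl
  · refine ⟨x, by simpa using hx, ?_⟩
    have : shiftOp A i (x i) x = Function.update x i 0 := by
      unfold shiftOp; rw [if_pos ⟨rfl, hi⟩]
    rw [this]
    apply Finset.card_lt_card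
    refine Finset.ssubset_iff_subset_ne.2 ⟨hle x, fun heq => ?_⟩
    have hxi : x i ≠ 0 := by
      intro h0
      apply hi
      rw [← h0, Function.update_eq_self]; exact hx
    have : i ∈ Finset.univ.filter (fun j => x j ≠ 0) := by simpa using hxi
    rw [← heq] at this
    simp at this

abbrev Step {G : Type*} [AddCommGroup G] {n : ℕ} (A₁ A₂ : Set (ZMod n → G)) : Prop :=
  ∃ i a, A₂ = (shiftOp A₁ i a) '' A₁

lemma exists_fixed {G : Type*} [AddCommGroup G] [Fintype G] {n : ℕ} [NeZero n] {b d : ℕ} (m : ℕ) :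
    ∀ A : Set (ZMod n → G), mu A ≤ m → Diam b d A →
      ∃ B, Relation.ReflTransGen Step A B ∧ Fixed B ∧ Diam b d B := by
  induction m with
  | zero =>
    intro A hm hD
    refine ⟨A, .refl, ?_, hD⟩
    intro x hx i
    by_contra hi
    have := mu_shift_lt A x hx i hi
    omega
  | succ m ih =>
    intro A hm hD
    by_cases hF : Fixed A
    · exact ⟨A, .refl, hF, hD⟩
    · unfold Fixed at hF
      push Not at hF
      obtain ⟨x, hx, i, hi⟩ := hF
      have := mu_shift_lt A x hx i hi
      obtain ⟨B, h1, h2, h3⟩ := ih _ (by omega) (shift_diam i (x i) hD)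
      exact ⟨B, .head ⟨i, x i, rfl⟩ h1, h2, h3⟩

lemma ncard_steps {G : Type*} [AddCommGroup G] {n : ℕ} {A B : Set (ZMod n → G)}
    (h : Relation.ReflTransGen Step A B) : A.ncard = B.ncard := by
  induction h with
  | refl => rfl
  | tail _ h ih =>
    obtain ⟨i, a, rfl⟩ := h
    rw [ih, Set.ncard_image_of_injOn (shift_injOn _ _ _)]

end KB

/-- Kleitman-type theorem for the burst metric: for fixed q, d, b and all
sufficiently large n, any set of burst diameter at most 2d has size at most
|Ball_{d,b}(0)|, with equality iff the set can be transformed into Ball_{d,b}(0) by a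
finite sequence of shifting operations. -/
theorem kleitman_burst_metric {G : Type*} [AddCommGroup G] [Fintype G]
    (q d b : ℕ) (hq : Fintype.card G = q) (hq2 : 2 ≤ q) (hb : 1 ≤ b) (hd : 1 ≤ d) :
    ∃ n₀ : ℕ, ∀ n ≥ n₀, ∀ A : Set (ZMod n → G),
      (∀ x ∈ A, ∀ y ∈ A, burstDist b x y ≤ 2 * d) →
      A.ncard ≤ (burstBall b d (0 : ZMod n → G)).ncard ∧
      (A.ncard = (burstBall b d (0 : ZMod n → G)).ncard ↔
        Relation.ReflTransGen
          (fun A₁ A₂ : Set (ZMod n → G) => ∃ i a, A₂ = (shiftOp A₁ i a) '' A₁)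
          A (burstBall b d (0 : ZMod n → G))) := by
  subst hq
  refine ⟨2 * d + 2 ^ d * d.factorial *
    Fintype.card G ^ (2 * d * b * (b * b) + (d - 1) * b) + 1, fun n hn A hA => ?_⟩
  haveI : NeZero n := ⟨by omega⟩
  have hD : KB.Diam b d A := fun x hx y hy => (KB.burstDist_le_iff hb x y).1 (hA x hx y hy)
  obtain ⟨B, hAB, hF, hDB⟩ := KB.exists_fixed (KB.mu A) A le_rfl hD
  have hc := KB.ncard_steps hAB
  have hm := KB.fixed_main hb hd hq2 (by omega) (by omega) hF hDB
  refine ⟨?_, ?_, fun h => KB.ncard_steps h⟩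
  · rw [hc]
    rcases hm with h | h
    · exact Set.ncard_le_ncard h (Set.toFinite _)
    · exact h.le
  · intro heq
    rcases hm with h | h
    · have : B = burstBall b d (0 : ZMod n → G) :=
        Set.eq_of_subset_of_ncard_le h (by omega) (Set.toFinite _)
      rw [← this]; exact hAB
    · omega
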